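/- Assume the standard setup with r < t, G not isomorphic to the star K_{1,e}, and e + s ≥ c_r, where s ≥ 1. Let r + 1 ≤ i ≤ t (so Vᵢ is a singleton consisting of a pendant vertex). If c_{j−1} ≤ e < c_j for some 2 ≤ j ≤ r, then s + t − r + b ≤ χ_la(G(Vᵢ,s)) ≤ s + t − r + j − 1. -/

import Mathlib

open Finset
open scoped Classical

namespace LocalAntimagic

variable {V : Type*}

/-- The induced vertex label: sum of the labels of edges incident to `v`. -/
noncomputable def vertexSum [Fintype V] (G : SimpleGraph V) (f : Sym2 V → ℕ) (v : V) : ℕ :=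
  ∑ e ∈ G.incidenceFinset v, f e

/-- `f` is a local antimagic labeling of `G`: a bijection from the edge set onto
`{1, …, |E|}` whose induced vertex labels distinguish adjacent vertices. -/
def IsLocalAntimagic [Fintype V] (G : SimpleGraph V) (f : Sym2 V → ℕ) : Prop :=
  Set.BijOn f G.edgeSet (Set.Icc 1 G.edgeFinset.card) ∧
  ∀ ⦃u v : V⦄, G.Adj u v → vertexSum G f u ≠ vertexSum G f v

/-- The color number `c(f)`: the number of distinct induced vertex labels. -/
noncomputable def colorCount [Fintype V] (G : SimpleGraph V) (f : Sym2 V → ℕ) : ℕ :=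
  (Finset.univ.image (vertexSum G f)).card

/-- The local antimagic chromatic number. -/
noncomputable def chiLA [Fintype V] (G : SimpleGraph V) : ℕ :=
  sInf {n | ∃ f, IsLocalAntimagic G f ∧ colorCount G f = n}

/-- A pendant vertex is a vertex of degree 1. -/
def IsPendant [Fintype V] (G : SimpleGraph V) (v : V) : Prop :=
  G.degree v = 1

/-- The number of pendant vertices of `G`. -/
noncomputable def pendantCount [Fintype V] (G : SimpleGraph V) : ℕ :=
  (Finset.univ.filter (fun v => IsPendant G v)).card

/-- `G(S, s)`: the graph obtained from `G` by attaching `s` new pendant edges to every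
vertex of `S`.  The new pendant vertex attached to `w ∈ S` via the `j`-th new edge is
`Sum.inr (w, j)`; the original graph lives on the `Sum.inl` vertices. -/
def attachPendants (G : SimpleGraph V) (S : Finset V) (s : ℕ) :
    SimpleGraph (V ⊕ (S × Fin s)) :=
  SimpleGraph.fromRel (fun a b =>
    (∃ u v : V, a = Sum.inl u ∧ b = Sum.inl v ∧ G.Adj u v) ∨
    (∃ (w : S) (j : Fin s), a = Sum.inl (w : V) ∧ b = Sum.inr (w, j)))

/-- The standard setup: `G` is a connected graph with at least `2` edges and
`χ_la(G) = t ≥ 2`; `f` is a local antimagic labeling of `G` with `c(f) = t` whose color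
classes are `Vset 1, …, Vset t` (each nonempty, with `f⁺ ≡ c i` on `Vset i`, and the
colors `c 1, …, c t` pairwise distinct); every non-pendant vertex lies in
`Vset 1 ∪ ⋯ ∪ Vset r` where `1 ≤ r ≤ t`; each `Vset i` with `r + 1 ≤ i ≤ t` is a
singleton consisting of a pendant vertex; `c 1 < c 2 < ⋯ < c r` and
`c (r+1) < c (r+2) < ⋯ < c t`. -/
structure StandardSetup [Fintype V] (G : SimpleGraph V) (f : Sym2 V → ℕ)
    (t r : ℕ) (Vset : ℕ → Finset V) (c : ℕ → ℕ) : Prop where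
  connected : G.Connected
  two_le_card_edges : 2 ≤ G.edgeFinset.card
  chiLA_eq : chiLA G = t
  two_le_t : 2 ≤ t
  antimagic : IsLocalAntimagic G f
  colorCount_eq : colorCount G f = t
  color_on_class : ∀ i ∈ Finset.Icc 1 t, ∀ v ∈ Vset i, vertexSum G f v = c i
  class_cover : ∀ v : V, ∃ i ∈ Finset.Icc 1 t, v ∈ Vset i
  class_nonempty : ∀ i ∈ Finset.Icc 1 t, (Vset i).Nonempty
  color_injective : ∀ i ∈ Finset.Icc 1 t, ∀ j ∈ Finset.Icc 1 t, i ≠ j → c i ≠ c j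
  one_le_r : 1 ≤ r
  r_le_t : r ≤ t
  nonpendant_mem : ∀ v : V, ¬ IsPendant G v → ∃ i ∈ Finset.Icc 1 r, v ∈ Vset i
  pendant_singleton : ∀ i ∈ Finset.Icc (r + 1) t, ∃ v : V, IsPendant G v ∧ Vset i = {v}
  c_strictMono_low : ∀ i j : ℕ, 1 ≤ i → i < j → j ≤ r → c i < c j
  c_strictMono_high : ∀ i j : ℕ, r + 1 ≤ i → i < j → j ≤ t → c i < c j

/-- `b`: the number of pendant vertices of `G` lying in `Vset 1 ∪ ⋯ ∪ Vset r`. -/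
noncomputable def pendantsInLow [Fintype V] (G : SimpleGraph V)
    (Vset : ℕ → Finset V) (r : ℕ) : ℕ :=
  (((Finset.Icc 1 r).biUnion Vset).filter (fun v => IsPendant G v)).card

lemma vertexSum_eq_sum [Fintype V] (G : SimpleGraph V) (f : Sym2 V → ℕ) (v : V) :
    vertexSum G f v = ∑ w, if G.Adj v w then f s(v, w) else 0 := by
  rw [← Finset.sum_filter]
  refine (Finset.sum_bij (fun w _ => s(v, w)) ?_ ?_ ?_ ?_).symm
  · intro w hw
    simpa [SimpleGraph.mem_incidenceFinset, SimpleGraph.mk'_mem_incidenceSet_iff] using hw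
  · intro a _ b _ h
    exact Sym2.congr_right.mp h
  · intro e he
    rw [SimpleGraph.mem_incidenceFinset] at he
    obtain ⟨w, rfl⟩ := Sym2.mem_iff_exists.mp he.2
    exact ⟨w, by simpa using he.1, rfl⟩
  · intro _ _
    rfl

lemma le_vertexSum [Fintype V] {G : SimpleGraph V} (f : Sym2 V → ℕ) {v w : V}
    (h : G.Adj v w) : f s(v, w) ≤ vertexSum G f v := by
  have := Finset.single_le_sum (f := fun x => if G.Adj v x then f s(v, x) else 0)
    (fun _ _ => Nat.zero_le _) (mem_univ w)
  rw [vertexSum_eq_sum]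
  simpa [h] using this

lemma isPendant_iff_exists [Fintype V] {G : SimpleGraph V} {v : V} :
    IsPendant G v ↔ ∃ w, ∀ x, G.Adj v x ↔ x = w := by
  unfold IsPendant
  rw [← SimpleGraph.card_neighborFinset_eq_degree, Finset.card_eq_one]
  simp [Finset.ext_iff]

lemma IsPendant.exists_adj [Fintype V] {G : SimpleGraph V} {v : V} (h : IsPendant G v)
    (f : Sym2 V → ℕ) : ∃ w, G.Adj v w ∧ vertexSum G f v = f s(v, w) := by
  obtain ⟨w, hw⟩ := isPendant_iff_exists.mp h
  exact ⟨w, (hw w).mpr rfl, by simp [vertexSum_eq_sum, hw]⟩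

lemma IsLocalAntimagic.pendantCount_lt_colorCount [Fintype V] {G : SimpleGraph V}
    {f : Sym2 V → ℕ} (hf : IsLocalAntimagic G f) (hG : 1 ≤ G.edgeFinset.card) :
    pendantCount G < colorCount G f := by
  obtain ⟨hbij, hne⟩ := hf
  obtain ⟨x, hx⟩ : ∃ x, G.edgeFinset.card < vertexSum G f x := by
    obtain ⟨z, hz, hfz⟩ := hbij.surjOn (Set.mem_Icc.mpr ⟨hG, le_rfl⟩)
    induction z with
    | _ a b =>
      have hab : G.Adj a b := hz
      have ha := le_vertexSum f hab
      have hb := le_vertexSum f hab.symm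
      rw [Sym2.eq_swap] at hb
      have := hne hab
      by_cases h : G.edgeFinset.card < vertexSum G f a
      · exact ⟨a, h⟩
      · exact ⟨b, by omega⟩
  have hinj : Set.InjOn (vertexSum G f) (univ.filter fun v => IsPendant G v) := by
    intro p hp q hq hpq
    obtain ⟨w, hw, hpw⟩ := IsPendant.exists_adj (by simpa using hp) f
    obtain ⟨y, hy, hqy⟩ := IsPendant.exists_adj (by simpa using hq) f
    have := hbij.injOn (show s(p, w) ∈ G.edgeSet from hw) (show s(q, y) ∈ G.edgeSet from hy)
      (by omega)
    rcases Sym2.eq_iff.mp this with h | h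
    · exact h.1
    · rw [h.2] at hw
      exact absurd hpq (hne hw)
  rw [pendantCount, colorCount, ← Finset.card_image_of_injOn hinj]
  refine Finset.card_lt_card ((Finset.ssubset_iff_of_subset ?_).mpr
    ⟨vertexSum G f x, mem_image_of_mem _ (mem_univ x), ?_⟩)
  · exact Finset.image_subset_image (Finset.filter_subset _ _)
  · intro h
    obtain ⟨p, hp, hpx⟩ := mem_image.mp h
    obtain ⟨w, hw, hpw⟩ := IsPendant.exists_adj (by simpa using hp) f
    have := (hbij.mapsTo (show s(p, w) ∈ G.edgeSet from hw)).2
    omega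

section attachPendants

variable (G : SimpleGraph V) (S : Finset V) (s : ℕ)

@[simp] lemma attachPendants_adj_inl_inl (a b : V) :
    (attachPendants G S s).Adj (Sum.inl a) (Sum.inl b) ↔ G.Adj a b := by
  simp only [attachPendants, SimpleGraph.fromRel_adj]
  constructor
  · rintro ⟨-, h⟩
    simpa [G.adj_comm b a] using h
  · intro h
    exact ⟨by simpa using h.ne, by simp [h]⟩

@[simp] lemma attachPendants_adj_inl_inr (a : V) (x : S × Fin s) :
    (attachPendants G S s).Adj (Sum.inl a) (Sum.inr x) ↔ a = x.1 := by
  rcases x with ⟨w, k⟩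
  simp [attachPendants, eq_comm]

@[simp] lemma attachPendants_adj_inr_inl (a : V) (x : S × Fin s) :
    (attachPendants G S s).Adj (Sum.inr x) (Sum.inl a) ↔ a = x.1 := by
  rw [SimpleGraph.adj_comm, attachPendants_adj_inl_inr]

@[simp] lemma attachPendants_adj_inr_inr (x y : S × Fin s) :
    ¬ (attachPendants G S s).Adj (Sum.inr x) (Sum.inr y) := by
  simp [attachPendants]

lemma isPendant_attachPendants_inr [Fintype V] (x : S × Fin s) :
    IsPendant (attachPendants G S s) (Sum.inr x) := by
  refine isPendant_iff_exists.mpr ⟨Sum.inl x.1, ?_⟩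
  rintro (a | y) <;> simp

lemma isPendant_attachPendants_inl [Fintype V] {p : V} (hp : IsPendant G p) (hpS : p ∉ S) :
    IsPendant (attachPendants G S s) (Sum.inl p) := by
  obtain ⟨w, hw⟩ := isPendant_iff_exists.mp hp
  refine isPendant_iff_exists.mpr ⟨Sum.inl w, ?_⟩
  rintro (a | y)
  · simp [hw]
  · simp only [attachPendants_adj_inl_inr, reduceCtorEq, iff_false]
    rintro rfl
    exact hpS y.1.2

lemma pendantCount_add_le_attachPendants [Fintype V] (v : V) :
    pendantCount G + s ≤ pendantCount (attachPendants G {v} s) + 1 := by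
  have hsub : ((univ.filter fun p => IsPendant G p).erase v).disjSum
      (univ : Finset (({v} : Finset V) × Fin s)) ⊆
      univ.filter fun p => IsPendant (attachPendants G {v} s) p := by
    rintro (p | x) h
    · simp only [inl_mem_disjSum, mem_erase, mem_filter, mem_univ, true_and] at h ⊢
      exact isPendant_attachPendants_inl G {v} s h.2 (by simpa using h.1)
    · simpa using isPendant_attachPendants_inr G {v} s x
  have hcard := Finset.card_le_card hsub
  have herase := Finset.pred_card_le_card_erase (s := univ.filter fun p => IsPendant G p) (a := v)
  rw [card_disjSum] at hcard
  simp only [card_univ, Fintype.card_prod, Fintype.card_coe, card_singleton, Fintype.card_fin,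
    one_mul] at hcard
  unfold pendantCount
  omega

end attachPendants

/-- The labeling of `attachPendants G S s` extending `f` in which the `k`-th new edge at every
vertex of `S` gets the label `e + 1 + k`. -/
def extendLabeling (f : Sym2 V → ℕ) (e : ℕ) (S : Finset V) (s : ℕ) :
    Sym2 (V ⊕ (S × Fin s)) → ℕ :=
  Sym2.lift ⟨fun
    | .inl a, .inl b => f s(a, b)
    | .inl _, .inr x => e + 1 + x.2
    | .inr x, .inl _ => e + 1 + x.2
    | .inr _, .inr _ => 0, by rintro (a | x) (b | y) <;> simp [Sym2.eq_swap]⟩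

section extendLabeling

variable (f : Sym2 V → ℕ) (e : ℕ) (S : Finset V) (s : ℕ)

@[simp] lemma extendLabeling_inl_inl (a b : V) :
    extendLabeling f e S s s(.inl a, .inl b) = f s(a, b) := rfl

@[simp] lemma extendLabeling_inl_inr (a : V) (x : S × Fin s) :
    extendLabeling f e S s s(.inl a, .inr x) = e + 1 + x.2 := rfl

@[simp] lemma extendLabeling_inr_inl (a : V) (x : S × Fin s) :
    extendLabeling f e S s s(.inr x, .inl a) = e + 1 + x.2 := rfl

lemma vertexSum_extendLabeling_inr [Fintype V] (G : SimpleGraph V) (x : S × Fin s) :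
    vertexSum (attachPendants G S s) (extendLabeling f e S s) (.inr x) = e + 1 + x.2 := by
  simp [vertexSum_eq_sum]

lemma vertexSum_extendLabeling_inl_of_notMem [Fintype V] (G : SimpleGraph V) {a : V}
    (ha : a ∉ S) :
    vertexSum (attachPendants G S s) (extendLabeling f e S s) (.inl a) = vertexSum G f a := by
  have h : ∀ x : S × Fin s, a ≠ x.1 := by
    rintro x rfl
    exact ha x.1.2
  simp [vertexSum_eq_sum, h]

lemma lt_vertexSum_extendLabeling_inl [Fintype V] (G : SimpleGraph V) {a : V} (ha : a ∈ S)
    (hs : 1 ≤ s) (hpos : 1 ≤ vertexSum G f a) :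
    e + s < vertexSum (attachPendants G S s) (extendLabeling f e S s) (.inl a) := by
  have h := Finset.single_le_sum (f := fun x : S × Fin s => if a = x.1 then e + 1 + x.2 else 0)
    (fun _ _ => Nat.zero_le _) (mem_univ (⟨a, ha⟩, ⟨s - 1, by omega⟩))
  rw [vertexSum_eq_sum] at hpos ⊢
  simp only [Fintype.sum_sum_type, attachPendants_adj_inl_inl, extendLabeling_inl_inl,
    attachPendants_adj_inl_inr, extendLabeling_inl_inr]
  simp only [if_true] at h
  omega

lemma bijOn_extendLabeling (G : SimpleGraph V) (v : V)
    (hf : Set.BijOn f G.edgeSet (Set.Icc 1 e)) :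
    Set.BijOn (extendLabeling f e {v} s) (attachPendants G {v} s).edgeSet
      (Set.Icc 1 (e + s)) := by
  have hedge : ∀ z ∈ (attachPendants G {v} s).edgeSet,
      (∃ y ∈ G.edgeSet, z = y.map Sum.inl ∧ extendLabeling f e {v} s z = f y) ∨
      ∃ x, z = s(.inl v, .inr x) ∧ extendLabeling f e {v} s z = e + 1 + x.2 := by
    intro z
    induction z with
    | _ a b =>
      rw [SimpleGraph.mem_edgeSet]
      rcases a with a | x <;> rcases b with b | y
      · intro h
        exact .inl ⟨s(a, b), by simpa using h, by simp, rfl⟩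
      · intro h
        obtain rfl : a = v := by simpa [mem_singleton.mp y.1.2] using h
        exact .inr ⟨y, rfl, rfl⟩
      · intro h
        obtain rfl : b = v := by simpa [mem_singleton.mp x.1.2] using h
        exact .inr ⟨x, Sym2.eq_swap, rfl⟩
      · simp
  refine ⟨?_, ?_, ?_⟩
  · intro z hz
    rcases hedge z hz with ⟨y, hy, -, h⟩ | ⟨x, -, h⟩
    · have := hf.mapsTo hy
      rw [h]
      exact ⟨this.1, this.2.trans (Nat.le_add_right _ _)⟩
    · have := x.2.2
      rw [h]
      exact ⟨by omega, by omega⟩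
  · intro z hz z' hz' hzz
    rcases hedge z hz with ⟨y, hy, rfl, h⟩ | ⟨x, rfl, h⟩ <;>
      rcases hedge z' hz' with ⟨y', hy', rfl, h'⟩ | ⟨x', rfl, h'⟩
    · rw [hf.injOn hy hy' (by omega)]
    · have := (hf.mapsTo hy).2
      omega
    · have := (hf.mapsTo hy').2
      omega
    · obtain rfl : x = x' := Prod.ext (Subsingleton.elim _ _) (Fin.ext (by omega))
      rfl
  · rintro n ⟨hn₁, hn₂⟩
    by_cases hn : n ≤ e
    · obtain ⟨y, hy, rfl⟩ := hf.surjOn ⟨hn₁, hn⟩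
      induction y with
      | _ a b => exact ⟨s(.inl a, .inl b), by simpa using hy, rfl⟩
    · refine ⟨s(.inl v, .inr (⟨v, by simp⟩, ⟨n - (e + 1), by omega⟩)), by simp, ?_⟩
      simp only [extendLabeling_inl_inr]
      omega

lemma card_edgeFinset_of_bijOn [Fintype V] {G : SimpleGraph V} {f : Sym2 V → ℕ} {n : ℕ}
    (hf : Set.BijOn f G.edgeSet (Set.Icc 1 n)) : G.edgeFinset.card = n := by
  have h := hf.injOn.ncard_image
  rw [hf.image_eq, ← SimpleGraph.coe_edgeFinset, ← Finset.coe_Icc, Set.ncard_coe_finset,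
    Set.ncard_coe_finset, Nat.card_Icc] at h
  omega

lemma isLocalAntimagic_extendLabeling [Fintype V] {G : SimpleGraph V} {v : V}
    (hf : IsLocalAntimagic G f) (he : G.edgeFinset.card = e) (hs : 1 ≤ s)
    (hle : ∀ a, vertexSum G f a ≤ e + s) (hpos : 1 ≤ vertexSum G f v) :
    IsLocalAntimagic (attachPendants G {v} s) (extendLabeling f e {v} s) := by
  obtain ⟨hbij, hne⟩ := hf
  have hbij' := bijOn_extendLabeling f e s G v (he ▸ hbij)
  have hlt := lt_vertexSum_extendLabeling_inl f e {v} s G (mem_singleton_self v) hs hpos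
  have hold : ∀ a, a ≠ v → vertexSum (attachPendants G {v} s) (extendLabeling f e {v} s) (.inl a) =
      vertexSum G f a := fun a ha =>
    vertexSum_extendLabeling_inl_of_notMem f e {v} s G (by simpa using ha)
  refine ⟨by rwa [card_edgeFinset_of_bijOn hbij'], ?_⟩
  rintro (a | x) (b | y) h
  · rw [attachPendants_adj_inl_inl] at h
    by_cases ha : a = v
    · subst ha
      have := hle b
      rw [hold b h.ne']
      omega
    · by_cases hb : b = v
      · subst hb
        have := hle a
        rw [hold a ha]
        omega
      · rw [hold a ha, hold b hb]
        exact hne h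
  · obtain rfl : a = v := by simpa [mem_singleton.mp y.1.2] using h
    have := y.2.2
    rw [vertexSum_extendLabeling_inr]
    omega
  · obtain rfl : b = v := by simpa [mem_singleton.mp x.1.2] using h
    have := x.2.2
    rw [vertexSum_extendLabeling_inr]
    omega
  · simp at h

end extendLabeling

namespace StandardSetup

variable [Fintype V] {G : SimpleGraph V} {f : Sym2 V → ℕ} {t r : ℕ} {Vset : ℕ → Finset V}
  {c : ℕ → ℕ}

lemma eq_of_mem (h : StandardSetup G f t r Vset c) {k l : ℕ} (hk : k ∈ Icc 1 t)
    (hl : l ∈ Icc 1 t) {a : V} (hak : a ∈ Vset k) (hal : a ∈ Vset l) : k = l := by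
  by_contra hne
  exact h.color_injective k hk l hl hne
    ((h.color_on_class k hk a hak).symm.trans (h.color_on_class l hl a hal))

lemma le_pendantCount (h : StandardSetup G f t r Vset c) :
    t - r + pendantsInLow G Vset r ≤ pendantCount G := by
  have hlow : ∀ k ∈ Icc 1 r, k ∈ Icc 1 t := fun k hk =>
    mem_Icc.mpr ⟨(mem_Icc.mp hk).1, (mem_Icc.mp hk).2.trans h.r_le_t⟩
  have hhigh : ∀ k ∈ Icc (r + 1) t, k ∈ Icc 1 t := fun k hk =>
    mem_Icc.mpr ⟨by have := (mem_Icc.mp hk).1; omega, (mem_Icc.mp hk).2⟩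
  have hcard : ((Icc (r + 1) t).biUnion Vset).card = t - r := by
    rw [card_biUnion, Finset.sum_congr rfl (g := fun _ => 1)]
    · simp
    · intro k hk
      obtain ⟨v, -, hv⟩ := h.pendant_singleton k hk
      rw [hv, card_singleton]
    · intro k hk l hl hkl
      exact disjoint_left.mpr fun a hak hal =>
        hkl (h.eq_of_mem (hhigh k hk) (hhigh l hl) hak hal)
  rw [← hcard, pendantsInLow, ← card_union_of_disjoint, pendantCount]
  · refine card_le_card (union_subset ?_ (filter_subset_filter _ (subset_univ _)))
    intro a ha
    obtain ⟨k, hk, hak⟩ := mem_biUnion.mp ha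
    obtain ⟨v, hvp, hv⟩ := h.pendant_singleton k hk
    rw [hv, mem_singleton] at hak
    simpa [hak] using hvp
  · refine disjoint_left.mpr fun a ha hb => ?_
    obtain ⟨k, hk, hak⟩ := mem_biUnion.mp ha
    obtain ⟨l, hl, hal⟩ := mem_biUnion.mp (mem_filter.mp hb).1
    have := h.eq_of_mem (hhigh k hk) (hlow l hl) hak hal
    have := (mem_Icc.mp hk).1
    have := (mem_Icc.mp hl).2
    omega

lemma le_color_of_le (h : StandardSetup G f t r Vset c) {k l : ℕ} (hk : 1 ≤ k) (hkl : k ≤ l)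
    (hl : l ≤ r) : c k ≤ c l := by
  rcases hkl.eq_or_lt with rfl | hlt
  · exact le_rfl
  · exact (h.c_strictMono_low k l hk hlt hl).le

lemma vertexSum_le (h : StandardSetup G f t r Vset c) {n : ℕ} (hcr : c r ≤ n)
    (hcard : G.edgeFinset.card ≤ n) (a : V) : vertexSum G f a ≤ n := by
  by_cases ha : IsPendant G a
  · obtain ⟨w, hw, hsum⟩ := ha.exists_adj f
    exact hsum ▸ (h.antimagic.1.mapsTo (show s(a, w) ∈ G.edgeSet from hw)).2.trans hcard
  · obtain ⟨k, hk, hak⟩ := h.nonpendant_mem a ha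
    have hk' := mem_Icc.mp hk
    rw [h.color_on_class k (mem_Icc.mpr ⟨hk'.1, hk'.2.trans h.r_le_t⟩) a hak]
    exact (h.le_color_of_le hk'.1 hk'.2 le_rfl).trans hcr

lemma colorCount_extendLabeling_le (h : StandardSetup G f t r Vset c) {e s i j : ℕ} {v : V}
    (hbig : c r ≤ e + s) (hi₁ : r + 1 ≤ i) (hi₂ : i ≤ t) (hv : Vset i = {v})
    (hce : e < c j) (hj : 1 ≤ j) :
    colorCount (attachPendants G {v} s) (extendLabeling f e {v} s) ≤
      s + (t - r) + (j - 1) := by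
  set F := vertexSum (attachPendants G {v} s) (extendLabeling f e {v} s) with hF
  have hsub : univ.image F ⊆ ((Icc 1 (j - 1)).image c ∪ ((Icc (r + 1) t).erase i).image c) ∪
      insert (F (.inl v)) (Icc (e + 1) (e + s)) := by
    intro n hn
    obtain ⟨a | x, -, rfl⟩ := mem_image.mp hn
    · by_cases ha : a = v
      · subst ha
        simp
      obtain ⟨k, hk, hak⟩ := h.class_cover a
      have hki : k ≠ i := by
        rintro rfl
        exact ha (by simpa [hv] using hak)
      rw [hF, vertexSum_extendLabeling_inl_of_notMem f e {v} s G (a := a) (by simpa using ha),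
        h.color_on_class k hk a hak]
      have hk' := mem_Icc.mp hk
      by_cases hkj : k ≤ j - 1
      · exact mem_union_left _ (mem_union_left _
          (mem_image_of_mem c (mem_Icc.mpr ⟨hk'.1, hkj⟩)))
      · by_cases hkr : k ≤ r
        · have h₁ := h.le_color_of_le hj (by omega : j ≤ k) hkr
          have h₂ := h.le_color_of_le hk'.1 hkr le_rfl
          exact mem_union_right _ (mem_insert_of_mem (mem_Icc.mpr ⟨by omega, by omega⟩))
        · exact mem_union_left _ (mem_union_right _ (mem_image_of_mem c
            (mem_erase.mpr ⟨hki, mem_Icc.mpr ⟨by omega, hk'.2⟩⟩)))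
    · have := x.2.2
      rw [hF, vertexSum_extendLabeling_inr]
      exact mem_union_right _ (mem_insert_of_mem (mem_Icc.mpr ⟨by omega, by omega⟩))
  have h₁ : ((Icc 1 (j - 1)).image c).card ≤ j - 1 := card_image_le.trans (by simp)
  have h₂ : (((Icc (r + 1) t).erase i).image c).card ≤ t - r - 1 :=
    card_image_le.trans (by rw [card_erase_of_mem (mem_Icc.mpr ⟨hi₁, hi₂⟩)]; simp)
  have h₃ : (insert (F (.inl v)) (Icc (e + 1) (e + s))).card ≤ s + 1 :=
    (card_insert_le _ _).trans (by simp)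
  have h₄ := (card_le_card hsub).trans ((card_union_le _ _).trans
    (Nat.add_le_add_right (card_union_le _ _) _))
  rw [colorCount, ← hF]
  omega

end StandardSetup

/-- Theorem 2.2(2), bounds: in the standard setup with `r < t`, `G`
not isomorphic to the star `K_{1,e}` and `e + s ≥ c_r` with `s ≥ 1`, for
`r + 1 ≤ i ≤ t` (so `Vᵢ` is a singleton pendant class): if `c_{j-1} ≤ e < c_j` for
some `2 ≤ j ≤ r`, then `s + t - r + b ≤ χ_la(G(Vᵢ, s)) ≤ s + t - r + j - 1`. -/
theorem chiLA_attachPendants_singleton_bounds [Fintype V] (G : SimpleGraph V)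
    (f : Sym2 V → ℕ) (t r : ℕ) (Vset : ℕ → Finset V) (c : ℕ → ℕ)
    (setup : StandardSetup G f t r Vset c) (hrt : r < t)
    (e s i j b : ℕ) (he : G.edgeFinset.card = e)
    (hb : pendantsInLow G Vset r = b)
    (hstar : ¬ Nonempty (G ≃g completeBipartiteGraph (Fin 1) (Fin e)))
    (hs : 1 ≤ s) (hbig : c r ≤ e + s)
    (hi₁ : r + 1 ≤ i) (hi₂ : i ≤ t)
    (hj₁ : 2 ≤ j) (hj₂ : j ≤ r)
    (hce₁ : c (j - 1) ≤ e) (hce₂ : e < c j) :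
    s + (t - r) + b ≤ chiLA (attachPendants G (Vset i) s) ∧
    chiLA (attachPendants G (Vset i) s) ≤ s + (t - r) + (j - 1) := by
  obtain ⟨v, hvp, hv⟩ := setup.pendant_singleton i (mem_Icc.mpr ⟨hi₁, hi₂⟩)
  rw [hv]
  have hpos : 1 ≤ vertexSum G f v := by
    obtain ⟨w, hw, hsum⟩ := hvp.exists_adj f
    exact hsum ▸ (setup.antimagic.1.mapsTo (show s(v, w) ∈ G.edgeSet from hw)).1
  have hanti := isLocalAntimagic_extendLabeling f e s setup.antimagic he hs
    (setup.vertexSum_le hbig (by omega)) hpos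
  have hedges := card_edgeFinset_of_bijOn
    (bijOn_extendLabeling f e s G v (he ▸ setup.antimagic.1))
  unfold chiLA
  constructor
  · refine le_csInf ⟨_, _, hanti, rfl⟩ ?_
    rintro _ ⟨g, hg, rfl⟩
    have h₁ := hg.pendantCount_lt_colorCount (by omega)
    have h₂ := pendantCount_add_le_attachPendants G s v
    have h₃ := setup.le_pendantCount
    omega
  · refine le_trans (Nat.sInf_le ?_)
      (setup.colorCount_extendLabeling_le hbig hi₁ hi₂ hv hce₂ (by omega))
    exact ⟨_, hanti, rfl⟩

end LocalAntimagic
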